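/- Let R = Dih(Z_3³) be the generalised dihedral group over the elementary abelian group A = ⟨e₁,e₂,e₃⟩ of order 27, with inverting involution x, and let S = { x, e₁x, e₂x, e₃x, e₁e₂x, e₁²e₂²x, e₂e₃x, e₂²e₃²x, e₁²e₂²e₃²x } (an inverse-closed set of involutions). Then the automorphism group of Γ = Cay(R,S) has order 46656 = 2⁶·3⁶ and contains exactly two conjugacy classes of regular subgroups isomorphic to R. Consequently Γ is not a DCI-graph and R = Dih(Z_3³) is not a CI-group. -/

import Mathlib

def IsDCIGraph {R : Type*} [Group R] (S : Set R) : Prop :=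
  ∀ T : Set R,
    (∃ e : R ≃ R, ∀ x y : R, x * y⁻¹ ∈ S ↔ e x * (e y)⁻¹ ∈ T) →
    ∃ φ : R ≃* R, φ '' S = T

def IsCIGroup (R : Type*) [Group R] : Prop := ∀ S : Set R, S⁻¹ = S → IsDCIGraph S

/-- The automorphisms of the Cayley graph `Cay(R,S)`, as a set of permutations of `R`. -/
def CayAut {R : Type*} [Group R] (S : Set R) : Set (Equiv.Perm R) :=
  {σ | ∀ u v : R, u * v⁻¹ ∈ S ↔ σ u * (σ v)⁻¹ ∈ S}

/-- A subgroup of `Sym(R)` is regular if it acts transitively with trivial point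
stabilisers. -/
def IsRegularSubgroup {V : Type*} (X : Subgroup (Equiv.Perm V)) : Prop :=
  (∀ u v : V, ∃ τ ∈ X, τ u = v) ∧ (∀ τ ∈ X, (∃ u : V, τ u = u) → τ = 1)

/-- `X` is a regular subgroup of `Aut(Cay(R,S))` isomorphic to `R`. -/
def IsRegularRSubgroupOfAut {R : Type*} [Group R] (S : Set R)
    (X : Subgroup (Equiv.Perm R)) : Prop :=
  (X : Set (Equiv.Perm R)) ⊆ CayAut S ∧ IsRegularSubgroup X ∧ Nonempty (X ≃* R)

/-- `X` and `Y` are conjugate by an element of `Aut(Cay(R,S))`. -/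
def ConjInAut {R : Type*} [Group R] (S : Set R) (X Y : Subgroup (Equiv.Perm R)) : Prop :=
  ∃ σ ∈ CayAut S, ∀ τ : Equiv.Perm R, τ ∈ X ↔ σ * τ * σ⁻¹ ∈ Y

/-- `θ` is an isomorphism from `Cay(R,S)` to `Cay(R,T)`. -/
def IsCayIso {R : Type*} [Group R] (S T : Set R) (θ : Equiv.Perm R) : Prop :=
  ∀ u v : R, u * v⁻¹ ∈ S ↔ θ u * (θ v)⁻¹ ∈ T

/-- The right regular representation of `R`, transported along the permutation `θ`. -/
def conjRight {R : Type*} [Group R] (θ : Equiv.Perm R) : R →* Equiv.Perm R where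
  toFun r := θ * Equiv.mulRight r⁻¹ * θ⁻¹
  map_one' := by ext u; simp
  map_mul' r s := by ext u; simp [mul_assoc]

section Babai

variable {R : Type*} [Group R]

theorem conjRight_apply (θ : Equiv.Perm R) (r u : R) :
    conjRight θ r (θ u) = θ (u * r⁻¹) := by
  simp [conjRight]

theorem IsCayIso.symm {S T : Set R} {θ : Equiv.Perm R} (h : IsCayIso S T θ) :
    IsCayIso T S θ.symm := fun u v => by
  simpa using (h (θ.symm u) (θ.symm v)).symm

theorem IsCayIso.trans {S T U : Set R} {θ η : Equiv.Perm R} (h : IsCayIso S T θ)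
    (h' : IsCayIso T U η) : IsCayIso S U (θ.trans η) := fun u v =>
  (h u v).trans (h' _ _)

theorem MulEquiv.isCayIso {S T : Set R} (φ : R ≃* R) (h : φ '' S = T) :
    IsCayIso S T φ.toEquiv := fun u v => by
  subst h
  have : φ.toEquiv u * (φ.toEquiv v)⁻¹ = φ (u * v⁻¹) := by simp
  rw [this, φ.injective.mem_set_image]

theorem isRegularRSubgroupOfAut_range_conjRight {S T : Set R} {θ : Equiv.Perm R}
    (h : IsCayIso T S θ) : IsRegularRSubgroupOfAut S (conjRight θ).range := by
  refine ⟨?_, ⟨?_, ?_⟩, ⟨(MonoidHom.ofInjective ?_).symm⟩⟩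
  · rintro _ ⟨r, rfl⟩ u v
    obtain ⟨u, rfl⟩ := θ.surjective u
    obtain ⟨v, rfl⟩ := θ.surjective v
    rw [conjRight_apply, conjRight_apply, ← h, ← h]
    simp
  · intro u v
    obtain ⟨u, rfl⟩ := θ.surjective u
    obtain ⟨v, rfl⟩ := θ.surjective v
    exact ⟨_, ⟨v⁻¹ * u, rfl⟩, by rw [conjRight_apply]; simp⟩
  · rintro _ ⟨r, rfl⟩ ⟨u, hu⟩
    obtain ⟨u, rfl⟩ := θ.surjective u
    rw [conjRight_apply] at hu
    have : r = 1 := by simpa using θ.injective hu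
    rw [this, map_one]
  · intro r s hrs
    have := congrArg (fun τ : Equiv.Perm R => τ (θ 1)) hrs
    simpa [conjRight_apply] using this

theorem exists_eq_range_conjRight {S : Set R} {Z : Subgroup (Equiv.Perm R)}
    (h : IsRegularRSubgroupOfAut S Z) :
    ∃ (θ : Equiv.Perm R) (T : Set R), IsCayIso T S θ ∧ Z = (conjRight θ).range := by
  obtain ⟨haut, ⟨htrans, hfree⟩, ⟨ψ⟩⟩ := h
  have hbij : Function.Bijective fun r : R => (ψ.symm r⁻¹ : Equiv.Perm R) 1 := by
    constructor
    · intro r s hrs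
      have h1 : (ψ.symm (s * r⁻¹) : Equiv.Perm R) = 1 := by
        refine hfree _ (ψ.symm _).2 ⟨1, ?_⟩
        have : (ψ.symm (s * r⁻¹) : Equiv.Perm R)
            = (ψ.symm s⁻¹ : Equiv.Perm R)⁻¹ * (ψ.symm r⁻¹ : Equiv.Perm R) := by
          rw [map_mul]; simp
        rw [this, Equiv.Perm.mul_apply, Equiv.Perm.inv_eq_iff_eq]
        exact hrs
      have h2 : ψ.symm (s * r⁻¹) = 1 := Subtype.ext h1
      rw [map_eq_one_iff _ ψ.symm.injective] at h2
      exact (mul_inv_eq_one.1 h2).symm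
    · intro v
      obtain ⟨τ, hτ, h1⟩ := htrans 1 v
      exact ⟨(ψ ⟨τ, hτ⟩)⁻¹, by simpa using h1⟩
  let θ : Equiv.Perm R := Equiv.ofBijective _ hbij
  have hθ : ∀ r, θ r = (ψ.symm r⁻¹ : Equiv.Perm R) 1 := fun _ => rfl
  have hact : ∀ s u, (ψ.symm s : Equiv.Perm R) (θ u) = θ (u * s⁻¹) := by
    intro s u
    rw [hθ, hθ, mul_inv_rev, inv_inv, map_mul]
    rfl
  have heq : ∀ s, conjRight θ s = ψ.symm s := by
    intro s
    ext u
    obtain ⟨u, rfl⟩ := θ.surjective u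
    rw [conjRight_apply, hact]
  refine ⟨θ, {r | θ r * (θ 1)⁻¹ ∈ S}, ?_, ?_⟩
  · intro u v
    have := haut (ψ.symm v).2 (θ u) (θ v)
    rw [hact, hact, mul_inv_cancel] at this
    exact this.symm
  · ext τ
    constructor
    · intro hτ
      exact ⟨ψ ⟨τ, hτ⟩, by rw [heq]; simp⟩
    · rintro ⟨s, rfl⟩
      rw [heq]
      exact (ψ.symm s).2

theorem conjInAut_range_conjRight {S T U : Set R} {θ η : Equiv.Perm R} (hθ : IsCayIso T S θ)
    (hη : IsCayIso U S η) (φ : R ≃* R) (hφ : φ '' T = U) :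
    ConjInAut S (conjRight θ).range (conjRight η).range := by
  refine ⟨θ.symm.trans (φ.toEquiv.trans η),
    hθ.symm.trans ((φ.isCayIso hφ).trans hη), fun τ => ?_⟩
  set σ : Equiv.Perm R := θ.symm.trans (φ.toEquiv.trans η) with hσ
  have key : ∀ s, σ * conjRight θ s * σ⁻¹ = conjRight η (φ s) := by
    intro s
    rw [mul_inv_eq_iff_eq_mul]
    ext u
    obtain ⟨u, rfl⟩ := θ.surjective u
    simp [hσ, conjRight_apply]
  constructor
  · rintro ⟨s, rfl⟩
    exact ⟨φ s, (key s).symm⟩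
  · rintro ⟨s, hs⟩
    refine ⟨φ.symm s, ?_⟩
    have := key (φ.symm s)
    rw [φ.apply_symm_apply, hs] at this
    simpa using this

theorem exists_mulEquiv_of_conjInAut {S T U : Set R} {θ η : Equiv.Perm R} (hθ : IsCayIso T S θ)
    (hη : IsCayIso U S η) (h : ConjInAut S (conjRight θ).range (conjRight η).range) :
    ∃ φ : R ≃* R, φ '' T = U := by
  obtain ⟨σ, hσ, hc⟩ := h
  obtain ⟨τ, hτ⟩ : ∃ τ : Equiv.Perm R, τ = θ.trans (Equiv.trans σ η.symm) := ⟨_, rfl⟩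
  have hiso : IsCayIso T U τ := hτ ▸ hθ.trans (IsCayIso.trans (T := S) hσ hη.symm)
  have hnorm : ∀ s, ∃ t, ∀ u, τ (u * s) = τ u * t := by
    intro s
    obtain ⟨t, ht⟩ := (hc (conjRight θ s⁻¹)).1 ⟨_, rfl⟩
    refine ⟨t⁻¹, fun u => ?_⟩
    have h1 := congrArg (fun π : Equiv.Perm R => π (η (τ u))) ht
    simp only [conjRight_apply] at h1
    rw [← η.apply_eq_iff_eq, h1]
    simp [hτ, -map_inv, conjRight_apply]
  have hmul : ∀ u s, τ (u * s) = τ u * (τ 1)⁻¹ * τ s := by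
    intro u s
    obtain ⟨t, ht⟩ := hnorm s
    have h1 := ht 1
    rw [one_mul] at h1
    rw [ht, h1]
    group
  refine ⟨{ toEquiv := τ.trans (Equiv.mulRight (τ 1)⁻¹), map_mul' := fun u s => ?_ }, ?_⟩
  · simp [hmul u s, mul_assoc]
  · ext r
    constructor
    · rintro ⟨u, hu, rfl⟩
      have := (hiso u 1).1 (by simpa using hu)
      simpa using this
    · intro hr
      refine ⟨τ.symm (r * τ 1), ?_, by simp⟩
      have := (hiso (τ.symm (r * τ 1)) 1).2 (by simpa using hr)
      simpa using this

/-- Babai's criterion, for two classes: conjugacy classes of regular subgroups isomorphic to `R`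
correspond to `Aut(R)`-classes of connection sets giving an isomorphic Cayley graph. -/
theorem exists_two_classes {S T : Set R} {θ : Equiv.Perm R} (hθ : IsCayIso T S θ)
    (hST : ¬ ∃ φ : R ≃* R, φ '' S = T)
    (hall : ∀ (U : Set R) (η : Equiv.Perm R), IsCayIso U S η →
      (∃ φ : R ≃* R, φ '' U = S) ∨ ∃ φ : R ≃* R, φ '' U = T) :
    ∃ X Y : Subgroup (Equiv.Perm R),
      IsRegularRSubgroupOfAut S X ∧ IsRegularRSubgroupOfAut S Y ∧ ¬ ConjInAut S X Y ∧
      ∀ Z : Subgroup (Equiv.Perm R), IsRegularRSubgroupOfAut S Z →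
        ConjInAut S Z X ∨ ConjInAut S Z Y := by
  have h1 : IsCayIso S S (Equiv.refl R) := fun _ _ => Iff.rfl
  refine ⟨(conjRight (Equiv.refl R)).range, (conjRight θ).range,
    isRegularRSubgroupOfAut_range_conjRight h1, isRegularRSubgroupOfAut_range_conjRight hθ,
    fun h => hST (exists_mulEquiv_of_conjInAut h1 hθ h), fun Z hZ => ?_⟩
  obtain ⟨η, U, hη, rfl⟩ := exists_eq_range_conjRight hZ
  refine (hall U η hη).imp ?_ ?_
  · rintro ⟨φ, hφ⟩
    exact conjInAut_range_conjRight hη h1 φ hφ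
  · rintro ⟨φ, hφ⟩
    exact conjInAut_range_conjRight hη hθ φ hφ

end Babai

/-- The bipartite graph on two copies of `A` with bipartite adjacency relation `I`. -/
def bipAdj {A : Type*} (I : A → A → Prop) : A ⊕ A → A ⊕ A → Prop
  | .inl a, .inr b => I a b
  | .inr a, .inl b => I b a
  | _, _ => False

/-- The elementary abelian group of order 27. -/
abbrev A₂₇ : Type := ZMod 3 × ZMod 3 × ZMod 3

/-- Incidence of the point `P` of `AG(3,3)` with the non-vertical plane with coordinates `Q`. -/
def Incid (P Q : A₂₇) : Prop :=
  P.2.2 + Q.2.2 + P.1 * Q.1 + P.2.1 * Q.2.1 = 0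

instance (P Q : A₂₇) : Decidable (Incid P Q) :=
  inferInstanceAs (Decidable (_ = _))

section Incidence

theorem incid_comm {P Q : A₂₇} : Incid P Q ↔ Incid Q P := by
  unfold Incid
  constructor <;> intro h <;> linear_combination h

theorem three_eq_zero : (3 : ZMod 3) = 0 := by decide

/-- The difference `D` of two points is the direction of a line in a plane of slope `q`. -/
def InSlope (D : A₂₇) (q : ZMod 3 × ZMod 3) : Prop :=
  D.2.2 + D.1 * q.1 + D.2.1 * q.2 = 0

instance (D : A₂₇) (q : ZMod 3 × ZMod 3) : Decidable (InSlope D q) :=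
  inferInstanceAs (Decidable (_ = _))

theorem exists_incid_iff {P Q : A₂₇} :
    (∃ B, Incid P B ∧ Incid Q B) ↔ ∃ q, InSlope (P - Q) q := by
  unfold Incid InSlope
  constructor
  · rintro ⟨B, h1, h2⟩
    refine ⟨(B.1, B.2.1), ?_⟩
    simp only [Prod.fst_sub, Prod.snd_sub]
    linear_combination h1 - h2
  · rintro ⟨q, hq⟩
    simp only [Prod.fst_sub, Prod.snd_sub] at hq
    refine ⟨(q.1, q.2, -(P.2.2 + P.1 * q.1 + P.2.1 * q.2)), by ring, ?_⟩
    linear_combination -hq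

/-- `X` is the third point of the line through `P` and `Q`, in terms of incidence only. -/
def IsThird (P Q X : A₂₇) : Prop :=
  X ≠ P ∧ X ≠ Q ∧ (∀ B, Incid P B → Incid Q B → Incid X B) ∧
    ((¬ ∃ B, Incid P B ∧ Incid Q B) → ¬ ∃ B, Incid P B ∧ Incid X B)

set_option synthInstance.maxSize 1000 in
set_option synthInstance.maxHeartbeats 200000 in
theorem eq_neg_of_inSlope : ∀ D E : A₂₇, D ≠ 0 → E ≠ 0 → E ≠ D →
    (∀ q, InSlope D q → InSlope E q) →
    ((¬ ∃ q, InSlope D q) → ¬ ∃ q, InSlope E q) → E = -D := by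
  decide +kernel

theorem inSlope_neg {D : A₂₇} {q : ZMod 3 × ZMod 3} : InSlope (-D) q ↔ InSlope D q := by
  unfold InSlope
  simp only [Prod.fst_neg, Prod.snd_neg]
  constructor <;> intro h <;> linear_combination -h

theorem isThird_iff {P Q X : A₂₇} (hPQ : P ≠ Q) : IsThird P Q X ↔ X = -P - Q := by
  have h3 : ∀ P : A₂₇, P + P + P = 0 := by decide
  constructor
  · rintro ⟨h1, h2, h4, h5⟩
    have key := eq_neg_of_inSlope (P - Q) (P - X) (sub_ne_zero.2 hPQ) (sub_ne_zero.2 h1.symm)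
      (fun h => h2 (sub_right_injective h)) ?_ (by rwa [exists_incid_iff, exists_incid_iff] at h5)
    · have := h3 P
      have e1 : X = P - (P - X) := by abel
      rw [e1, key]
      rw [← sub_eq_zero, ← this]
      abel
    · intro q hq
      unfold InSlope at hq
      have := h4 (q.1, q.2, -(P.2.2 + P.1 * q.1 + P.2.1 * q.2)) (by unfold Incid; ring)
        (by unfold Incid; simp only [Prod.fst_sub, Prod.snd_sub] at hq; linear_combination -hq)
      unfold Incid at this
      unfold InSlope
      simp only [Prod.fst_sub, Prod.snd_sub]
      linear_combination -this
  · rintro rfl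
    refine ⟨fun h => hPQ ?_, fun h => hPQ ?_, ?_, ?_⟩
    · have e : P - Q = (-P - Q) - P + (P + P + P) := by abel
      rw [h3, h] at e
      rw [← sub_eq_zero, e]
      abel
    · have e : P - Q = -((-P - Q) - Q + (Q + Q + Q)) := by abel
      rw [h3, h] at e
      rw [← sub_eq_zero, e]
      abel
    · unfold Incid
      intro B h1 h2
      simp only [Prod.fst_sub, Prod.snd_sub, Prod.fst_neg, Prod.snd_neg]
      linear_combination -h1 - h2 + B.2.2 * three_eq_zero
    · rw [exists_incid_iff, exists_incid_iff]
      rintro h ⟨q, hq⟩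
      refine h ⟨q, ?_⟩
      have e : P - (-P - Q) = -(P - Q) + (P + P + P) := by abel
      rw [e, h3, add_zero, inSlope_neg] at hq
      exact hq

theorem eq_of_incid_iff {P Q : A₂₇} (h : ∀ B, Incid P B ↔ Incid Q B) : P = Q := by
  have h0 := (h (0, 0, -P.2.2)).1 (by simp [Incid])
  have h1 := (h (1, 0, -P.2.2 - P.1)).1 (by simp [Incid]; ring)
  have h2 := (h (0, 1, -P.2.2 - P.2.1)).1 (by simp [Incid]; ring)
  simp only [Incid] at h0 h1 h2
  refine Prod.ext ?_ (Prod.ext ?_ ?_)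
  · linear_combination h0 - h1
  · linear_combination h0 - h2
  · linear_combination -h0

/-- Parameters `(M, t, l, c, d)` of a collineation of `AG(3,3)` preserving the vertical direction,
with `M` an invertible `2 × 2` matrix given by its entries, and `c ≠ 0`. -/
abbrev CollParam : Type :=
  {m : ZMod 3 × ZMod 3 × ZMod 3 × ZMod 3 // m.1 * m.2.2.2 - m.2.1 * m.2.2.1 ≠ 0} ×
    (ZMod 3 × ZMod 3) × (ZMod 3 × ZMod 3) × {c : ZMod 3 // c ≠ 0} × ZMod 3

/-- The action of a collineation on points. -/
def onPoints : CollParam → A₂₇ → A₂₇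
  | (⟨(a, b, a', b'), _⟩, t, l, c, d), P =>
    (a * P.1 + b * P.2.1 + t.1, a' * P.1 + b' * P.2.1 + t.2,
      c * P.2.2 + l.1 * P.1 + l.2 * P.2.1 + d)

/-- The slope of the image of a plane under a collineation. -/
def onSlopes : CollParam → A₂₇ → ZMod 3 × ZMod 3
  | (⟨(a, b, a', b'), _⟩, _, l, c, _), Q =>
    ((a * b' - b * a') * (b' * (c * Q.1 - l.1) - a' * (c * Q.2.1 - l.2)),
      (a * b' - b * a') * (a * (c * Q.2.1 - l.2) - b * (c * Q.1 - l.1)))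

/-- The action of a collineation on non-vertical planes. -/
def onPlanes (π : CollParam) (Q : A₂₇) : A₂₇ :=
  ((onSlopes π Q).1, (onSlopes π Q).2,
    π.2.2.2.1 * Q.2.2 - π.2.2.2.2 - π.2.1.1 * (onSlopes π Q).1 - π.2.1.2 * (onSlopes π Q).2)

theorem sq_eq_one_of_ne_zero : ∀ c : ZMod 3, c ≠ 0 → c ^ 2 = 1 := by decide

theorem incid_onPoints_onPlanes (π : CollParam) (P Q : A₂₇) :
    Incid (onPoints π P) (onPlanes π Q) ↔ Incid P Q := by
  obtain ⟨⟨⟨a, b, a', b'⟩, hm⟩, ⟨t, t'⟩, ⟨l, l'⟩, ⟨c, hc⟩, d⟩ := π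
  have hc' := sq_eq_one_of_ne_zero c hc
  have hm' := sq_eq_one_of_ne_zero _ hm
  unfold Incid
  simp only [onPoints, onPlanes, onSlopes] at *
  rw [← mul_eq_zero_iff_left hc (b := P.2.2 + Q.2.2 + P.1 * Q.1 + P.2.1 * Q.2.1)]
  refine Eq.congr_left ?_
  linear_combination (P.1 * (c * Q.1 - l) + P.2.1 * (c * Q.2.1 - l')) * hm'

theorem onPoints_injective : Function.Injective onPoints := by
  rintro ⟨⟨⟨a, b, a', b'⟩, hm⟩, ⟨t, t'⟩, ⟨l, l'⟩, ⟨c, hc⟩, d⟩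
    ⟨⟨⟨a₁, b₁, a₁', b₁'⟩, hm₁⟩, ⟨t₁, t₁'⟩, ⟨l₁, l₁'⟩, ⟨c₁, hc₁⟩, d₁⟩ h
  have h0 := congrFun h (0, 0, 0)
  have h1 := congrFun h (1, 0, 0)
  have h2 := congrFun h (0, 1, 0)
  have h3 := congrFun h (0, 0, 1)
  simp only [onPoints, Prod.mk.injEq, mul_zero, mul_one, add_zero, zero_add] at h0 h1 h2 h3
  obtain ⟨rfl, rfl, rfl⟩ := h0
  simp only [add_left_inj] at h1 h2 h3
  obtain ⟨rfl, rfl, rfl⟩ := h1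
  obtain ⟨rfl, rfl, rfl⟩ := h2
  obtain ⟨-, -, rfl⟩ := h3
  rfl

theorem det_ne_zero_of_forall : ∀ a b a' b' : ZMod 3,
    (∀ x y : ZMod 3, (x ≠ 0 ∨ y ≠ 0) → (a * x + b * y ≠ 0 ∨ a' * x + b' * y ≠ 0)) →
    a * b' - b * a' ≠ 0 := by
  decide

theorem exists_inSlope_iff : ∀ D : A₂₇,
    (∃ q, InSlope D q) ↔ (D.1 ≠ 0 ∨ D.2.1 ≠ 0 ∨ D.2.2 = 0) := by
  decide

theorem exists_eq_onPoints {g h : A₂₇ → A₂₇} (hg : Function.Injective g)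
    (hh : Function.Surjective h) (hgh : ∀ P Q, Incid (g P) (h Q) ↔ Incid P Q) :
    ∃ π, g = onPoints π := by
  have hex : ∀ P Q, (∃ B, Incid (g P) B ∧ Incid (g Q) B) ↔ ∃ B, Incid P B ∧ Incid Q B := by
    intro P Q
    rw [hh.exists]
    simp only [hgh]
  have hthird : ∀ P Q X, IsThird P Q X → IsThird (g P) (g Q) (g X) := by
    rintro P Q X ⟨h1, h2, h3, h4⟩
    refine ⟨hg.ne h1, hg.ne h2, ?_, ?_⟩
    · rw [hh.forall]
      simpa only [hgh] using h3
    · rwa [hex, hex]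
  have h3 : ∀ P : A₂₇, P + P + P = 0 := by decide
  have hline : ∀ P Q, g (-P - Q) = -g P - g Q := by
    intro P Q
    by_cases hPQ : P = Q
    · subst hPQ
      have e : ∀ P : A₂₇, -P - P = P := by decide
      rw [e, e]
    · exact (isThird_iff (hg.ne hPQ)).1 (hthird _ _ _ ((isThird_iff hPQ).2 rfl))
  have hneg : ∀ P, g (-P) = -g P - g 0 := by
    intro P
    simpa using hline P 0
  have hadd : ∀ P Q, g (P + Q) - g 0 = (g P - g 0) + (g Q - g 0) := by
    intro P Q
    have h1 := hline (-P) (-Q)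
    rw [hneg, hneg] at h1
    have e : - -P - -Q = P + Q := by abel
    rw [e] at h1
    have e2 := h3 (g 0)
    have e3 : -(-g P - g 0) - (-g Q - g 0) - g 0
        = (g P - g 0) + (g Q - g 0) + (g 0 + g 0 + g 0) := by abel
    rw [h1, e3, e2, add_zero]
  let L : A₂₇ →+ A₂₇ := AddMonoidHom.mk' (fun P => g P - g 0) hadd
  have hL : ∀ P, L P = g P - g 0 := fun _ => rfl
  have hlin : ∀ P : A₂₇, L P = P.1 • L (1, 0, 0) + P.2.1 • L (0, 1, 0) + P.2.2 • L (0, 0, 1) := by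
    intro P
    rw [← ZMod.map_smul L, ← ZMod.map_smul L, ← ZMod.map_smul L, ← map_add, ← map_add]
    simp
  have hslope : ∀ D, (∃ q, InSlope (L D) q) ↔ ∃ q, InSlope D q := by
    intro D
    rw [hL, ← exists_incid_iff, hex, exists_incid_iff, sub_zero]
  simp only [exists_inSlope_iff] at hslope
  obtain ⟨⟨a, a', l⟩, h1⟩ : ∃ v, v = L (1, 0, 0) := ⟨_, rfl⟩
  obtain ⟨⟨b, b', l'⟩, h2⟩ : ∃ v, v = L (0, 1, 0) := ⟨_, rfl⟩
  obtain ⟨⟨u, u', c⟩, h4⟩ : ∃ v, v = L (0, 0, 1) := ⟨_, rfl⟩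
  rw [← h1, ← h2, ← h4] at hlin
  have hv := hslope (0, 0, 1)
  rw [← h4] at hv
  have hv' : ¬ (u ≠ 0 ∨ u' ≠ 0 ∨ c = 0) := by
    rw [hv]
    decide
  push Not at hv'
  obtain ⟨rfl, rfl, hc⟩ := hv'
  have hdet : a * b' - b * a' ≠ 0 := by
    refine det_ne_zero_of_forall _ _ _ _ fun x y hxy => ?_
    by_contra! hcon
    obtain ⟨z, hz⟩ : ∃ z : ZMod 3, x * l + y * l' + z * c ≠ 0 := by
      by_cases h0 : x * l + y * l' = 0
      · exact ⟨1, by simpa [h0] using hc⟩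
      · exact ⟨0, by simpa using h0⟩
    have hs := hslope (x, y, z)
    rw [hlin] at hs
    simp only [Prod.smul_mk, smul_eq_mul, Prod.mk_add_mk, mul_zero, add_zero] at hs
    rw [mul_comm x a, mul_comm y b, mul_comm x a', mul_comm y b', hcon.1, hcon.2] at hs
    rcases hxy with hx | hy
    · have := hs.2 (Or.inl hx)
      simp [hz] at this
    · have := hs.2 (Or.inr (Or.inl hy))
      simp [hz] at this
  refine ⟨(⟨(a, b, a', b'), hdet⟩, ((g 0).1, (g 0).2.1), (l, l'), ⟨c, hc⟩, (g 0).2.2), ?_⟩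
  funext P
  have e : g P = L P + g 0 := by rw [hL]; abel
  rw [e, hlin]
  simp only [onPoints, Prod.smul_mk, smul_eq_mul, mul_zero]
  refine Prod.ext ?_ (Prod.ext ?_ ?_)
  · simp only [Prod.fst_add]; ring
  · simp only [Prod.fst_add, Prod.snd_add]; ring
  · simp only [Prod.snd_add]; ring

/-- The automorphisms of a relation, as a set of permutations. -/
def relAut {V : Type*} (r : V → V → Prop) : Set (Equiv.Perm V) :=
  {σ | ∀ u v, r u v ↔ r (σ u) (σ v)}

theorem eq_of_bipAdj_incid_iff {u v : A₂₇ ⊕ A₂₇}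
    (h : ∀ w, bipAdj Incid u w ↔ bipAdj Incid v w) : u = v := by
  rcases u with P | P <;> rcases v with Q | Q
  · exact congrArg _ (eq_of_incid_iff fun B => h (.inr B))
  · exact absurd ((h (.inr (0, 0, -P.2.2))).1 (by simp [bipAdj, Incid])) id
  · exact absurd ((h (.inl (0, 0, -P.2.2))).1 (by simp [bipAdj, Incid])) id
  · refine congrArg _ (eq_of_incid_iff fun B => ?_)
    rw [incid_comm, incid_comm (P := Q)]
    exact h (.inl B)

theorem bipAdj_incid_swap (u v : A₂₇ ⊕ A₂₇) :
    bipAdj Incid u v ↔ bipAdj Incid u.swap v.swap := by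
  rcases u with P | P <;> rcases v with Q | Q <;> simp [bipAdj, incid_comm]

theorem bipAdj_incid_sumMap (π : CollParam) (u v : A₂₇ ⊕ A₂₇) :
    bipAdj Incid u v ↔
      bipAdj Incid (u.map (onPoints π) (onPlanes π)) (v.map (onPoints π) (onPlanes π)) := by
  rcases u with P | P <;> rcases v with Q | Q <;> simp [bipAdj, incid_onPoints_onPlanes]

theorem sumMap_bijective (π : CollParam) :
    Function.Bijective (Sum.map (onPoints π) (onPlanes π)) := by
  refine Finite.injective_iff_bijective.1 fun u v huv => eq_of_bipAdj_incid_iff fun w => ?_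
  rw [bipAdj_incid_sumMap π, huv, ← bipAdj_incid_sumMap]

/-- The automorphism of the incidence graph given by a collineation, composed with the polarity
exchanging points and planes if the boolean is `true`. -/
noncomputable def incidPerm : Bool × CollParam → Equiv.Perm (A₂₇ ⊕ A₂₇)
  | (false, π) => Equiv.ofBijective _ (sumMap_bijective π)
  | (true, π) => (Equiv.ofBijective _ (sumMap_bijective π)).trans (Equiv.sumComm _ _)

theorem incidPerm_injective : Function.Injective incidPerm := by
  rintro ⟨b, π⟩ ⟨b', π'⟩ h
  have key : ∀ P, incidPerm (b, π) (.inl P) = incidPerm (b', π') (.inl P) := fun P => by rw [h]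
  have h' : b = b' ∧ onPoints π = onPoints π' := by
    cases b <;> cases b' <;> simp [incidPerm] at key ⊢ <;> exact funext fun P => by simp [key]
  rw [h'.1, onPoints_injective h'.2]

theorem exists_path : ∀ P : A₂₇, ∃ Q₁, Incid 0 Q₁ ∧ ∃ P₁, Incid P₁ Q₁ ∧
    ∃ Q₂, Incid P₁ Q₂ ∧ Incid P Q₂ := by
  decide +kernel

theorem isLeft_ne_of_bipAdj {A : Type*} {I : A → A → Prop} {u v : A ⊕ A} (h : bipAdj I u v) :
    u.isLeft = !v.isLeft := by
  rcases u with P | P <;> rcases v with Q | Q <;> simp [bipAdj] at h ⊢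

theorem exists_incidPerm_false {σ : Equiv.Perm (A₂₇ ⊕ A₂₇)} (hσ : σ ∈ relAut (bipAdj Incid))
    (h0 : (σ (.inl 0)).isLeft = true) : ∃ π, σ = incidPerm (false, π) := by
  have hadj : ∀ P Q, Incid P Q → (σ (.inl P)).isLeft = !(σ (.inr Q)).isLeft := fun P Q h =>
    isLeft_ne_of_bipAdj ((hσ (.inl P) (.inr Q)).1 h)
  have hl : ∀ P, (σ (.inl P)).isLeft = true := by
    intro P
    obtain ⟨Q₁, h1, P₁, h2, Q₂, h3, h4⟩ := exists_path P
    have e1 := hadj _ _ h1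
    have e2 := hadj _ _ h2
    have e3 := hadj _ _ h3
    have e4 := hadj _ _ h4
    rw [e4, ← e3, e2, ← e1, h0]
  have hr : ∀ Q, (σ (.inr Q)).isRight = true := by
    intro Q
    have := hadj (0, 0, -Q.2.2) Q (by simp [Incid])
    rw [hl] at this
    rw [← Sum.bnot_isLeft, ← this]
  choose g hg using fun P => Sum.isLeft_iff.1 (hl P)
  choose h hh using fun Q => Sum.isRight_iff.1 (hr Q)
  have hginj : Function.Injective g := fun P Q e =>
    Sum.inl_injective (σ.injective (by rw [hg, hg, e]))
  have hhinj : Function.Injective h := fun P Q e =>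
    Sum.inr_injective (σ.injective (by rw [hh, hh, e]))
  have hinc : ∀ P Q, Incid (g P) (h Q) ↔ Incid P Q := by
    intro P Q
    have := hσ (.inl P) (.inr Q)
    rw [hg, hh] at this
    exact this.symm
  obtain ⟨π, hπ⟩ := exists_eq_onPoints hginj (Finite.surjective_of_injective hhinj) hinc
  subst hπ
  refine ⟨π, Equiv.ext ?_⟩
  rintro (P | Q)
  · simp [hg, incidPerm]
  · rw [hh]
    refine congrArg Sum.inr (eq_of_incid_iff fun B => ?_)
    obtain ⟨P, rfl⟩ := (Finite.surjective_of_injective hginj) B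
    rw [incid_comm, hinc, incid_comm (P := onPlanes π Q), incid_onPoints_onPlanes]

theorem range_incidPerm : Set.range incidPerm = relAut (bipAdj Incid) := by
  have hswap : ∀ σ : Equiv.Perm (A₂₇ ⊕ A₂₇), σ ∈ relAut (bipAdj Incid) →
      σ.trans (Equiv.sumComm _ _) ∈ relAut (bipAdj Incid) := fun σ hσ u v =>
    (hσ u v).trans (bipAdj_incid_swap _ _)
  ext σ
  constructor
  · rintro ⟨⟨b, π⟩, rfl⟩
    cases b
    · exact bipAdj_incid_sumMap π
    · exact hswap (incidPerm (false, π)) (bipAdj_incid_sumMap π)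
  · intro hσ
    cases h0 : (σ (.inl 0)).isLeft
    · obtain ⟨π, hπ⟩ := exists_incidPerm_false (hswap σ hσ) (by simpa using h0)
      refine ⟨(true, π), ?_⟩
      ext u
      have := congrArg (fun τ : Equiv.Perm (A₂₇ ⊕ A₂₇) => (τ u).swap) hπ
      simpa [incidPerm] using this.symm
    · obtain ⟨π, rfl⟩ := exists_incidPerm_false hσ h0
      exact ⟨_, rfl⟩

theorem card_relAut_incid : Nat.card (relAut (bipAdj Incid)) = 46656 := by
  have hm : Fintype.card {m : ZMod 3 × ZMod 3 × ZMod 3 × ZMod 3 //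
      m.1 * m.2.2.2 - m.2.1 * m.2.2.1 ≠ 0} = 48 := by decide +kernel
  have hc : Fintype.card {c : ZMod 3 // c ≠ 0} = 2 := by decide
  rw [← range_incidPerm, Nat.card_range_of_injective incidPerm_injective,
    Nat.card_eq_fintype_card]
  simp [Fintype.card_prod, hm, hc, ZMod.card, -ne_eq, -Fintype.card_subtype_compl]

end Incidence

/-- Equivalence of subsets of an additive group under automorphisms and translations. -/
def AffEquivalent {A : Type*} [AddCommGroup A] (T U : Set A) : Prop :=
  ∃ (β : A ≃+ A) (b : A), ∀ a, a ∈ T ↔ β a + b ∈ U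

/-- The graph of the quadratic form `x² + ε y²` over `𝔽₃`. -/
def quadric (ε : ZMod 3) : Set A₂₇ :=
  {P | P.2.2 = P.1 ^ 2 + ε * P.2.1 ^ 2}

section Classification

theorem AffEquivalent.symm {A : Type*} [AddCommGroup A] {T U : Set A} (h : AffEquivalent T U) :
    AffEquivalent U T := by
  obtain ⟨β, b, h⟩ := h
  refine ⟨β.symm, -β.symm b, fun a => ?_⟩
  rw [h]
  simp

theorem AffEquivalent.trans {A : Type*} [AddCommGroup A] {T U V : Set A}
    (h : AffEquivalent T U) (h' : AffEquivalent U V) : AffEquivalent T V := by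
  obtain ⟨β, b, h⟩ := h
  obtain ⟨γ, c, h'⟩ := h'
  refine ⟨β.trans γ, γ b + c, fun a => ?_⟩
  rw [h, h']
  simp [add_assoc]

/-- A function `𝔽₃² → 𝔽₃` is bent if its nontrivial derivatives are balanced. -/
def IsBent (f : ZMod 3 → ZMod 3 → ZMod 3) : Prop :=
  ∀ a b : ZMod 3, (a ≠ 0 ∨ b ≠ 0) → ∀ δ : ZMod 3,
    (Finset.univ.filter fun p : ZMod 3 × ZMod 3 =>
      f (p.1 + a) (p.2 + b) - f p.1 p.2 = δ).card = 3

instance (f : ZMod 3 → ZMod 3 → ZMod 3) : Decidable (IsBent f) :=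
  by unfold IsBent; infer_instance

/-- The function on `𝔽₃²` vanishing at `(0,0)`, `(1,0)`, `(0,1)` with given other values. -/
def tableFun (v₁ v₂ v₃ v₄ v₅ v₆ : ZMod 3) : ZMod 3 → ZMod 3 → ZMod 3 :=
  (![![0, 0, v₁], ![0, v₂, v₃], ![v₄, v₅, v₆]] : Fin 3 → Fin 3 → ZMod 3)

theorem isBent_tableFun : ∀ v₁ v₂ v₃ v₄ v₅ v₆ : ZMod 3, IsBent (tableFun v₁ v₂ v₃ v₄ v₅ v₆) →
    v₃ = v₂ + v₂ + v₁ ∧ v₅ = v₂ + v₂ + v₄ ∧ v₆ = v₄ + v₁ + v₂ ∧ v₄ * v₁ - v₂ ^ 2 ≠ 0 := by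
  decide +kernel

theorem IsBent.eq_quadratic {f : ZMod 3 → ZMod 3 → ZMod 3} (hf : IsBent f) (h00 : f 0 0 = 0)
    (h10 : f 1 0 = 0) (h01 : f 0 1 = 0) :
    ∃ α β γ : ZMod 3, α * β - γ ^ 2 ≠ 0 ∧
      ∀ i j, f i j = α * (i ^ 2 - i) + β * (j ^ 2 - j) + γ * (i * j) := by
  have hall : ∀ P : ZMod 3 → Prop, P 0 → P 1 → P 2 → ∀ i, P i := by
    intro P h0 h1 h2 i
    fin_cases i
    exacts [h0, h1, h2]
  have htab : f = tableFun (f 0 2) (f 1 1) (f 1 2) (f 2 0) (f 2 1) (f 2 2) := by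
    funext i j
    revert i j
    refine hall _ (hall _ ?_ ?_ ?_) (hall _ ?_ ?_ ?_) (hall _ ?_ ?_ ?_)
    exacts [h00, h01, rfl, h10, rfl, rfl, rfl, rfl, rfl]
  obtain ⟨e1, e2, e3, e4⟩ := isBent_tableFun _ _ _ _ _ _ (htab ▸ hf)
  refine ⟨-f 2 0, -f 0 2, f 1 1, by convert e4 using 1; ring, ?_⟩
  refine hall _ (hall _ ?_ ?_ ?_) (hall _ ?_ ?_ ?_) (hall _ ?_ ?_ ?_)
  · rw [h00]; ring
  · rw [h01]; ring
  · linear_combination f 0 2 * three_eq_zero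
  · rw [h10]; ring
  · ring
  · rw [e1]; linear_combination f 0 2 * three_eq_zero
  · linear_combination f 2 0 * three_eq_zero
  · rw [e2]; linear_combination f 2 0 * three_eq_zero
  · rw [e3]; linear_combination (f 2 0 + f 0 2 - f 1 1) * three_eq_zero

theorem exists_diagonalisation : ∀ α β γ : ZMod 3, α * β - γ ^ 2 ≠ 0 →
    ∃ ε : ZMod 3, (ε = 1 ∨ ε = -1) ∧ ∃ a b c d : ZMod 3, a * d - b * c ≠ 0 ∧
      α = a ^ 2 + ε * c ^ 2 ∧ β = b ^ 2 + ε * d ^ 2 ∧ γ = 2 * (a * b + ε * c * d) := by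
  decide +kernel

/-- A linear automorphism of `𝔽₃³` preserving the vertical direction. -/
theorem exists_addEquiv_vertical {a b c d : ZMod 3} (h : a * d - b * c ≠ 0) (l l' : ZMod 3) :
    ∃ β : A₂₇ ≃+ A₂₇, ∀ P, β P =
      (a * P.1 + b * P.2.1, c * P.1 + d * P.2.1, P.2.2 + l * P.1 + l' * P.2.1) := by
  let β : A₂₇ →+ A₂₇ := AddMonoidHom.mk' (fun P =>
      (a * P.1 + b * P.2.1, c * P.1 + d * P.2.1, P.2.2 + l * P.1 + l' * P.2.1)) fun P Q => by
    simp only [Prod.fst_add, Prod.snd_add, Prod.mk_add_mk]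
    refine Prod.ext ?_ (Prod.ext ?_ ?_) <;> ring
  have hinj : Function.Injective β := by
    refine (injective_iff_map_eq_zero β).2 fun P hP => ?_
    simp only [β, AddMonoidHom.mk'_apply, Prod.mk_eq_zero] at hP
    obtain ⟨h1, h2, h3⟩ := hP
    have e1 : P.1 = 0 := (mul_eq_zero_iff_left h).1 (by linear_combination d * h1 - b * h2)
    have e2 : P.2.1 = 0 := (mul_eq_zero_iff_left h).1 (by linear_combination a * h2 - c * h1)
    exact Prod.ext e1 (Prod.ext e2 (by simpa [e1, e2] using h3))
  exact ⟨AddEquiv.ofBijective β (Finite.injective_iff_bijective.1 hinj), fun P => rfl⟩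

theorem IsBent.sub_affine {f : ZMod 3 → ZMod 3 → ZMod 3} (hf : IsBent f) (k l l' : ZMod 3) :
    IsBent fun i j => f i j - k - l * i - l' * j := by
  intro a b hab δ
  refine Eq.trans (congrArg _ (Finset.filter_congr fun p _ => ?_)) (hf a b hab (δ + l * a + l' * b))
  constructor <;> intro h <;> linear_combination h

theorem IsBent.affEquivalent_quadric {f : ZMod 3 → ZMod 3 → ZMod 3} (hf : IsBent f) :
    ∃ ε : ZMod 3, (ε = 1 ∨ ε = -1) ∧
      AffEquivalent {P : A₂₇ | P.2.2 = f P.1 P.2.1} (quadric ε) := by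
  obtain ⟨α, β, γ, hne, hq⟩ :=
    (hf.sub_affine (f 0 0) (f 1 0 - f 0 0) (f 0 1 - f 0 0)).eq_quadratic
      (by ring) (by ring) (by ring)
  obtain ⟨ε, hε, a, b, c, d, hdet, rfl, rfl, rfl⟩ := exists_diagonalisation α β γ hne
  obtain ⟨L, hL⟩ := exists_addEquiv_vertical hdet
    (-(f 1 0 - f 0 0) + (a ^ 2 + ε * c ^ 2)) (-(f 0 1 - f 0 0) + (b ^ 2 + ε * d ^ 2))
  refine ⟨ε, hε, L, (0, 0, -f 0 0), fun P => ?_⟩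
  have := hq P.1 P.2.1
  simp only [quadric, Set.mem_ofPred_eq, hL, Prod.mk_add_mk]
  constructor <;> intro h
  · linear_combination h + this
  · linear_combination h - this

theorem exists_addEquiv_apply_eq_vertical (h : A₂₇) :
    ∃ α : A₂₇ ≃+ A₂₇, (α h).1 = 0 ∧ (α h).2.1 = 0 := by
  have hshear : ∀ k m : ZMod 3, ∃ α : A₂₇ ≃+ A₂₇, ∀ P, α P =
      (P.1 - k * P.2.2, P.2.1 - m * P.2.2, P.2.2) := fun k m =>
    ⟨{ toFun := fun P => (P.1 - k * P.2.2, P.2.1 - m * P.2.2, P.2.2)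
       invFun := fun P => (P.1 + k * P.2.2, P.2.1 + m * P.2.2, P.2.2)
       left_inv := fun P => by simp
       right_inv := fun P => by simp
       map_add' := fun P Q => by
        simp only [Prod.fst_add, Prod.snd_add, Prod.mk_add_mk]
        refine Prod.ext ?_ (Prod.ext ?_ ?_) <;> ring }, fun _ => rfl⟩
  by_cases h3 : h.2.2 = 0
  · by_cases h2 : h.2.1 = 0
    · exact ⟨⟨⟨fun P => (P.2.2, P.2.1, P.1), fun P => (P.2.2, P.2.1, P.1), fun _ => rfl,
        fun _ => rfl⟩, fun _ _ => rfl⟩, h3, h2⟩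
    · obtain ⟨α, hα⟩ := hshear (h.1 * h.2.1) 0
      let s : A₂₇ ≃+ A₂₇ := ⟨⟨fun P => (P.1, P.2.2, P.2.1), fun P => (P.1, P.2.2, P.2.1),
        fun _ => rfl, fun _ => rfl⟩, fun _ _ => rfl⟩
      have e : α (s h) = (h.1 - h.1 * h.2.1 * h.2.1, h.2.2 - 0 * h.2.1, h.2.1) := hα _
      refine ⟨s.trans α, ?_, ?_⟩ <;> rw [AddEquiv.trans_apply, e]
      · linear_combination -h.1 * sq_eq_one_of_ne_zero _ h2
      · simpa using h3
  · obtain ⟨α, hα⟩ := hshear (h.1 * h.2.2) (h.2.1 * h.2.2)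
    refine ⟨α, ?_, ?_⟩ <;> rw [hα]
    · linear_combination -h.1 * sq_eq_one_of_ne_zero _ h3
    · linear_combination -h.2.1 * sq_eq_one_of_ne_zero _ h3

theorem exists_not_difference {T : Finset A₂₇} (hT : T.card = 9)
    (hN : ∀ a, a ≠ 0 → (T.filter fun t => a + t ∈ T).card = 0 ∨
      (T.filter fun t => a + t ∈ T).card = 3) :
    ∃ h, h ≠ 0 ∧ ∀ t ∈ T, h + t ∉ T := by
  by_contra! hcon
  have h3 : ∀ a ∈ (Finset.univ : Finset A₂₇).erase 0,
      (T.filter fun t => a + t ∈ T).card = 3 := by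
    intro a ha
    have ha' := Finset.ne_of_mem_erase ha
    refine (hN a ha').resolve_left fun h0 => ?_
    obtain ⟨t, ht, hat⟩ := hcon a ha'
    exact Finset.notMem_empty t (Finset.card_eq_zero.1 h0 ▸ Finset.mem_filter.2 ⟨ht, hat⟩)
  have hsum : ∑ a : A₂₇, (T.filter fun t => a + t ∈ T).card = 81 := by
    simp only [Finset.card_filter]
    rw [Finset.sum_comm]
    have : ∀ t ∈ T, (∑ a : A₂₇, if a + t ∈ T then 1 else 0) = 9 := by
      intro t _
      refine (Equiv.sum_comp (Equiv.addRight t) fun a => if a ∈ T then 1 else 0).trans ?_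
      simp [hT]
    rw [Finset.sum_congr rfl this]
    simp [hT]
  rw [← Finset.add_sum_erase _ _ (Finset.mem_univ (0 : A₂₇)), Finset.sum_congr rfl h3] at hsum
  simp [hT, ZMod.card] at hsum

theorem eq_or_eq_neg_of_ne_zero : ∀ c z : ZMod 3, c ≠ 0 → z ≠ 0 → z = c ∨ z = -c := by decide

theorem affEquivalent_quadric_of_card {T : Finset A₂₇} (hT : T.card = 9)
    (hN : ∀ a, a ≠ 0 → (T.filter fun t => a + t ∈ T).card = 0 ∨
      (T.filter fun t => a + t ∈ T).card = 3) :
    ∃ ε : ZMod 3, (ε = 1 ∨ ε = -1) ∧ AffEquivalent (T : Set A₂₇) (quadric ε) := by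
  obtain ⟨h, h0, hh⟩ := exists_not_difference hT hN
  obtain ⟨α, hα1, hα2⟩ := exists_addEquiv_apply_eq_vertical h
  have hα0 : (α h).2.2 ≠ 0 := fun h3 =>
    h0 ((map_eq_zero_iff α α.injective).1 (Prod.ext hα1 (Prod.ext hα2 h3)))
  let π : A₂₇ → ZMod 3 × ZMod 3 := fun t => ((α t).1, (α t).2.1)
  have hinj : Set.InjOn π T := by
    intro s hs t ht hst
    obtain ⟨e1, e2⟩ := Prod.mk.inj hst
    by_contra hne
    have hz : (α (s - t)).2.2 ≠ 0 := by
      intro hz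
      refine hne (sub_eq_zero.1 ((map_eq_zero_iff α α.injective).1 ?_))
      rw [map_sub] at hz ⊢
      exact Prod.ext (by simpa [sub_eq_zero] using e1)
        (Prod.ext (by simpa [sub_eq_zero] using e2) hz)
    rcases eq_or_eq_neg_of_ne_zero _ _ hα0 hz with hc | hc
    · refine hh t ht ?_
      have : h = s - t := α.injective (Prod.ext (by simp [hα1, e1])
        (Prod.ext (by simp [hα2, e2]) hc.symm))
      rwa [this, sub_add_cancel]
    · refine hh s hs ?_
      have : -h = s - t := α.injective (Prod.ext (by simp [hα1, e1])
        (Prod.ext (by simp [hα2, e2]) (by rw [hc, map_neg]; rfl)))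
      rw [← neg_neg h, this, neg_sub, sub_add_cancel]
      exact ht
  have himage : T.image π = Finset.univ := by
    rw [← Finset.card_eq_iff_eq_univ, Finset.card_image_of_injOn hinj, hT]
    rfl
  have hex : ∀ i j : ZMod 3, ∃ z, α.symm (i, j, z) ∈ T := by
    intro i j
    obtain ⟨t, ht, hp⟩ := Finset.mem_image.1 (himage ▸ Finset.mem_univ (i, j))
    obtain ⟨rfl, rfl⟩ := Prod.mk.inj hp
    exact ⟨(α t).2.2, by simpa using ht⟩
  choose f hf using hex
  have hmem : ∀ t, t ∈ T ↔ (α t).2.2 = f (α t).1 (α t).2.1 := by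
    intro t
    constructor
    · intro ht
      have := hinj ht (hf (α t).1 (α t).2.1) (by simp [π])
      have := congrArg α this
      rw [α.apply_symm_apply] at this
      exact congrArg (fun P => P.2.2) this
    · intro ht
      have := hf (α t).1 (α t).2.1
      rw [← ht] at this
      simpa using this
  have hbent : IsBent f := by
    intro a b hab
    have hle : ∀ δ, (Finset.univ.filter fun p : ZMod 3 × ZMod 3 =>
        f (p.1 + a) (p.2 + b) - f p.1 p.2 = δ).card = 0 ∨
        (Finset.univ.filter fun p : ZMod 3 × ZMod 3 =>
        f (p.1 + a) (p.2 + b) - f p.1 p.2 = δ).card = 3 := by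
      intro δ
      have hne : α.symm (a, b, δ) ≠ 0 := by
        rw [Ne, map_eq_zero_iff _ α.symm.injective]
        rintro he
        simp only [Prod.mk_eq_zero] at he
        rcases hab with h | h
        exacts [h he.1, h he.2.1]
      have hcard : (Finset.univ.filter fun p : ZMod 3 × ZMod 3 =>
          f (p.1 + a) (p.2 + b) - f p.1 p.2 = δ).card =
          (T.filter fun t => α.symm (a, b, δ) + t ∈ T).card := by
        refine Finset.card_nbij' (fun p => α.symm (p.1, p.2, f p.1 p.2)) π ?_ ?_ ?_ ?_
        · intro p hp
          have hp' : f (p.1 + a) (p.2 + b) - f p.1 p.2 = δ := by simpa using hp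
          refine Finset.mem_coe.2 (Finset.mem_filter.2 ⟨hf _ _, ?_⟩)
          rw [hmem]
          simp only [map_add, AddEquiv.apply_symm_apply, Prod.mk_add_mk]
          rw [add_comm a, add_comm b, ← hp']
          ring
        · intro t ht
          obtain ⟨h1, h2⟩ := Finset.mem_filter.1 (Finset.mem_coe.1 ht)
          rw [hmem] at h1 h2
          simp only [map_add, AddEquiv.apply_symm_apply, Prod.fst_add, Prod.snd_add] at h2
          refine Finset.mem_coe.2 (Finset.mem_filter.2 ⟨Finset.mem_univ _, ?_⟩)
          simp only [π]
          rw [add_comm _ a, add_comm _ b, ← h1, ← h2]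
          ring
        · intro p _
          simp [π]
        · intro t ht
          have h1 := (hmem t).1 (Finset.mem_filter.1 (Finset.mem_coe.1 ht)).1
          simp only [π]
          rw [← h1]
          simp
      rw [hcard]
      exact hN _ hne
    have hsum := Finset.card_eq_sum_card_fiberwise (s := Finset.univ) (t := Finset.univ)
      (f := fun p : ZMod 3 × ZMod 3 => f (p.1 + a) (p.2 + b) - f p.1 p.2)
      fun _ _ => Finset.mem_coe.2 (Finset.mem_univ _)
    have huniv : (Finset.univ : Finset (ZMod 3)) = {0, 1, 2} := rfl
    rw [huniv, Finset.sum_insert (by decide), Finset.sum_insert (by decide),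
      Finset.sum_singleton, Finset.card_univ] at hsum
    simp only [Fintype.card_prod, ZMod.card] at hsum
    have h0 := hle 0
    have h1 := hle 1
    have h2 := hle 2
    have hδ : ∀ δ : ZMod 3, δ = 0 ∨ δ = 1 ∨ δ = 2 := by decide
    intro δ
    rcases hδ δ with rfl | rfl | rfl <;> omega
  obtain ⟨ε, hε, hq⟩ := hbent.affEquivalent_quadric
  refine ⟨ε, hε, AffEquivalent.trans ⟨α, 0, fun t => ?_⟩ hq⟩
  simpa using hmem t

end Classification

/-- The bi-Cayley relation on two copies of `A` determined by `T`: `a` in the first copy is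
adjacent to `b` in the second copy if `a + b ∈ T`. -/
def sumAdj {A : Type*} [AddCommGroup A] (T : Set A) : A ⊕ A → A ⊕ A → Prop :=
  bipAdj fun a b => a + b ∈ T

section BiCayley

theorem AffEquivalent.exists_perm {A : Type*} [AddCommGroup A] {T U : Set A}
    (h : AffEquivalent T U) :
    ∃ ζ : Equiv.Perm (A ⊕ A), ∀ u v, sumAdj T u v ↔ sumAdj U (ζ u) (ζ v) := by
  obtain ⟨β, b, h⟩ := h
  refine ⟨Equiv.sumCongr β.toEquiv (β.toEquiv.trans (Equiv.addRight b)), ?_⟩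
  rintro (a | a) (c | c) <;> simp [sumAdj, bipAdj, h, add_assoc, add_left_comm]

theorem exists_perm_quadric_incid {ε : ZMod 3} (hε : ε = 1 ∨ ε = -1) :
    ∃ ζ : Equiv.Perm (A₂₇ ⊕ A₂₇),
      ∀ u v, sumAdj (quadric ε) u v ↔ bipAdj Incid (ζ u) (ζ v) := by
  have hsq : ε * ε = 1 := by rcases hε with rfl | rfl <;> rfl
  let f : A₂₇ ≃ A₂₇ :=
    { toFun := fun P => (P.1, P.2.1, P.2.2 - P.1 ^ 2 - ε * P.2.1 ^ 2)
      invFun := fun P => (P.1, P.2.1, P.2.2 + P.1 ^ 2 + ε * P.2.1 ^ 2)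
      left_inv := fun P => Prod.ext rfl (Prod.ext rfl (by ring))
      right_inv := fun P => Prod.ext rfl (Prod.ext rfl (by ring)) }
  let s : A₂₇ ≃ A₂₇ :=
    { toFun := fun P => (P.1, ε * P.2.1, P.2.2)
      invFun := fun P => (P.1, ε * P.2.1, P.2.2)
      left_inv := fun P => by simp [← mul_assoc, hsq]
      right_inv := fun P => by simp [← mul_assoc, hsq] }
  refine ⟨Equiv.sumCongr f (f.trans s), ?_⟩
  have key : ∀ P Q : A₂₇, P + Q ∈ quadric ε ↔ Incid (f P) (s (f Q)) := by
    intro P Q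
    simp only [quadric, Incid, Set.mem_ofPred_eq, Prod.fst_add, Prod.snd_add, f, s, Equiv.coe_fn_mk]
    constructor <;> intro h
    · linear_combination h + (P.1 * Q.1 + ε * P.2.1 * Q.2.1) * three_eq_zero
    · linear_combination h - (P.1 * Q.1 + ε * P.2.1 * Q.2.1) * three_eq_zero
  rintro (P | P) (Q | Q)
  exacts [Iff.rfl, key P Q, key Q P, Iff.rfl]

theorem card_inSlope : ∀ D : A₂₇, Fintype.card {q // InSlope D q} =
    if D = 0 then 9 else if D.1 = 0 ∧ D.2.1 = 0 then 0 else 3 := by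
  decide +kernel

theorem card_common_incid (P Q : A₂₇) : Nat.card {B // Incid P B ∧ Incid Q B} =
    Fintype.card {q // InSlope (P - Q) q} := by
  rw [← Nat.card_eq_fintype_card]
  refine Nat.card_congr
    { toFun := fun B => ⟨(B.1.1, B.1.2.1), ?_⟩
      invFun := fun q => ⟨(q.1.1, q.1.2, -(P.2.2 + P.1 * q.1.1 + P.2.1 * q.1.2)), ?_, ?_⟩
      left_inv := ?_
      right_inv := fun _ => rfl }
  · obtain ⟨B, h1, h2⟩ := B
    unfold Incid at h1 h2
    simp only [InSlope, Prod.fst_sub, Prod.snd_sub]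
    linear_combination h1 - h2
  · simp only [Incid]
    ring
  · obtain ⟨q, hq⟩ := q
    simp only [InSlope, Prod.fst_sub, Prod.snd_sub] at hq
    simp only [Incid]
    linear_combination -hq
  · rintro ⟨B, h1, h2⟩
    unfold Incid at h1
    refine Subtype.ext (Prod.ext rfl (Prod.ext rfl ?_))
    simp only
    linear_combination -h1

theorem card_common_bipAdj_incid (u v : A₂₇ ⊕ A₂₇) :
    (u = v → Nat.card {w // bipAdj Incid u w ∧ bipAdj Incid v w} = 9) ∧
    (u ≠ v → Nat.card {w // bipAdj Incid u w ∧ bipAdj Incid v w} = 0 ∨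
      Nat.card {w // bipAdj Incid u w ∧ bipAdj Incid v w} = 3) := by
  have hll : ∀ P Q, Nat.card {w // bipAdj Incid (.inl P) w ∧ bipAdj Incid (.inl Q) w} =
      Fintype.card {q // InSlope (P - Q) q} := by
    intro P Q
    rw [← card_common_incid]
    refine (Nat.card_congr (Equiv.ofBijective (fun B => ⟨.inr B.1, B.2⟩) ⟨?_, ?_⟩)).symm
    · intro B C h
      simpa [Subtype.ext_iff] using h
    · rintro ⟨R | R, h1, h2⟩
      · exact h1.elim
      · exact ⟨⟨R, h1, h2⟩, rfl⟩
  have hrr : ∀ u v, Nat.card {w // bipAdj Incid u w ∧ bipAdj Incid v w} =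
      Nat.card {w // bipAdj Incid u.swap w ∧ bipAdj Incid v.swap w} := fun u v =>
    Nat.card_congr ((Equiv.sumComm _ _).subtypeEquiv fun w => by
      rw [bipAdj_incid_swap u, bipAdj_incid_swap v]; rfl)
  have hmix : ∀ P Q, Nat.card {w // bipAdj Incid (.inl P) w ∧ bipAdj Incid (.inr Q) w} = 0 := by
    intro P Q
    have : IsEmpty {w // bipAdj Incid (.inl P) w ∧ bipAdj Incid (.inr Q) w} :=
      ⟨by rintro ⟨R | R, h1, h2⟩; exacts [h1, h2]⟩
    exact Nat.card_of_isEmpty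
  have hmain : ∀ P Q : A₂₇, (P = Q → Fintype.card {q // InSlope (P - Q) q} = 9) ∧
      (P ≠ Q → Fintype.card {q // InSlope (P - Q) q} = 0 ∨
        Fintype.card {q // InSlope (P - Q) q} = 3) := by
    intro P Q
    rw [card_inSlope]
    constructor
    · rintro rfl
      simp
    · intro h
      rw [if_neg (sub_ne_zero.2 h)]
      split_ifs <;> simp
  rcases u with P | P <;> rcases v with Q | Q
  · rw [hll]
    simpa using hmain P Q
  · rw [hmix]
    simp
  · rw [hrr]
    simp [hmix]
  · rw [hrr, Sum.swap_inr, Sum.swap_inr, hll]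
    simpa using hmain P Q

theorem affEquivalent_quadric_of_perm {T : Set A₂₇} {ζ : Equiv.Perm (A₂₇ ⊕ A₂₇)}
    (hζ : ∀ u v, sumAdj T u v ↔ bipAdj Incid (ζ u) (ζ v)) :
    ∃ ε : ZMod 3, (ε = 1 ∨ ε = -1) ∧ AffEquivalent T (quadric ε) := by
  classical
  have hcard : ∀ a, (T.toFinset.filter fun t => a + t ∈ T.toFinset).card =
      Nat.card {w // bipAdj Incid (ζ (.inl 0)) w ∧ bipAdj Incid (ζ (.inl a)) w} := by
    intro a
    rw [← Nat.card_congr (ζ.subtypeEquiv (p := fun w => sumAdj T (.inl 0) w ∧ sumAdj T (.inl a) w)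
        fun w => by rw [hζ, hζ]), ← Fintype.card_coe, ← Nat.card_eq_fintype_card]
    refine Nat.card_congr (Equiv.ofBijective (fun t => ⟨.inr t.1, ?_⟩) ⟨?_, ?_⟩)
    · obtain ⟨h1, h2⟩ := Finset.mem_filter.1 t.2
      refine ⟨?_, Set.mem_toFinset.1 h2⟩
      change 0 + t.1 ∈ T
      rw [zero_add]
      exact Set.mem_toFinset.1 h1
    · intro t u h
      exact Subtype.ext (Sum.inr_injective (congrArg Subtype.val h))
    · rintro ⟨w | w, h1, h2⟩
      · exact h1.elim
      · change 0 + w ∈ T at h1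
        rw [zero_add] at h1
        exact ⟨⟨w, Finset.mem_filter.2 ⟨Set.mem_toFinset.2 h1, Set.mem_toFinset.2 h2⟩⟩, rfl⟩
  have h9 : T.toFinset.card = 9 := by
    have := (card_common_bipAdj_incid (ζ (.inl 0)) (ζ (.inl 0))).1 rfl
    rw [← hcard 0] at this
    simpa only [zero_add, Finset.filter_mem_eq_inter, Finset.inter_self] using this
  have := affEquivalent_quadric_of_card h9 fun a ha => by
    rw [hcard]
    exact (card_common_bipAdj_incid _ _).2 fun h =>
      ha (Sum.inl_injective (ζ.injective h)).symm
  simpa using this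

theorem card_relAut_congr {V W : Type*} {r : V → V → Prop} {r' : W → W → Prop} (e : V ≃ W)
    (h : ∀ u v, r u v ↔ r' (e u) (e v)) : Nat.card (relAut r) = Nat.card (relAut r') := by
  refine Nat.card_congr (e.permCongr.subtypeEquiv fun σ => ?_)
  simp only [relAut, Set.mem_ofPred_eq, h]
  constructor
  · intro hσ u v
    simpa using hσ (e.symm u) (e.symm v)
  · intro hσ u v
    simpa using hσ (e u) (e v)

end BiCayley

/-- `E` identifies `R` with a generalised dihedral group over `A`: the first copy of `A` is the
abelian subgroup, the second copy consists of the involutions inverting it. -/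
structure IsDihCoord {A R : Type*} [AddCommGroup A] [Group R] (E : A ⊕ A ≃ R) : Prop where
  inl_mul_inl : ∀ a b, E (.inl a) * E (.inl b) = E (.inl (a + b))
  inl_mul_inr : ∀ a b, E (.inl a) * E (.inr b) = E (.inr (a + b))
  inr_mul_inl : ∀ a b, E (.inr a) * E (.inl b) = E (.inr (a - b))
  inr_mul_inr : ∀ a b, E (.inr a) * E (.inr b) = E (.inl (a - b))

/-- The set of reflections of a generalised dihedral group with coordinates in `T`. -/
def reflections {A R : Type*} (E : A ⊕ A ≃ R) (T : Set A) : Set R :=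
  (fun a => E (.inr a)) '' T

section Dihedral

theorem inr_mem_reflections {A R : Type*} {E : A ⊕ A ≃ R} {T : Set A} {a : A} :
    E (.inr a) ∈ reflections E T ↔ a ∈ T := by
  simp [reflections]

theorem inl_notMem_reflections {A R : Type*} {E : A ⊕ A ≃ R} {T : Set A} {a : A} :
    E (.inl a) ∉ reflections E T := by
  simp [reflections]

namespace IsDihCoord

variable {A R : Type*} [AddCommGroup A] [Group R] {E : A ⊕ A ≃ R}

theorem inl_zero (hE : IsDihCoord E) : E (.inl 0) = 1 := by
  have := hE.inl_mul_inl 0 0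
  simpa using this

theorem inv_inl (hE : IsDihCoord E) (a : A) : (E (.inl a))⁻¹ = E (.inl (-a)) := by
  rw [inv_eq_iff_mul_eq_one, hE.inl_mul_inl, add_neg_cancel, hE.inl_zero]

theorem inv_inr (hE : IsDihCoord E) (a : A) : (E (.inr a))⁻¹ = E (.inr a) := by
  rw [inv_eq_iff_mul_eq_one, hE.inr_mul_inr, sub_self, hE.inl_zero]

theorem mul_inv_mem_reflections (hE : IsDihCoord E) {T : Set A} (u v : A ⊕ A) :
    E u * (E v)⁻¹ ∈ reflections E T ↔ sumAdj T u v := by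
  rcases u with a | a <;> rcases v with b | b
  · rw [hE.inv_inl, hE.inl_mul_inl]
    exact iff_of_false inl_notMem_reflections id
  · rw [hE.inv_inr, hE.inl_mul_inr, inr_mem_reflections]
    rfl
  · rw [hE.inv_inl, hE.inr_mul_inl, inr_mem_reflections, sub_neg_eq_add, add_comm]
    rfl
  · rw [hE.inv_inr, hE.inr_mul_inr]
    exact iff_of_false inl_notMem_reflections id

theorem inv_reflections (hE : IsDihCoord E) (T : Set A) :
    (reflections E T)⁻¹ = reflections E T := by
  ext r
  obtain ⟨a | a, rfl⟩ := E.surjective r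
  · rw [Set.mem_inv, hE.inv_inl]
    exact iff_of_false inl_notMem_reflections inl_notMem_reflections
  · rw [Set.mem_inv, hE.inv_inr]

theorem exists_mulEquiv (hE : IsDihCoord E) {T U : Set A} (h : AffEquivalent T U) :
    ∃ φ : R ≃* R, φ '' reflections E T = reflections E U := by
  obtain ⟨β, b, h⟩ := h
  let ζ : Equiv.Perm (A ⊕ A) :=
    Equiv.sumCongr β.toEquiv (β.toEquiv.trans (Equiv.addRight b))
  have hζl : ∀ a, ζ (.inl a) = .inl (β a) := fun _ => rfl
  have hζr : ∀ a, ζ (.inr a) = .inr (β a + b) := fun _ => rfl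
  let φ : R ≃* R :=
    { toEquiv := E.symm.trans (ζ.trans E)
      map_mul' := fun r s => by
        obtain ⟨a | a, rfl⟩ := E.surjective r <;> obtain ⟨c | c, rfl⟩ := E.surjective s <;>
        simp [hE.inl_mul_inl, hE.inl_mul_inr, hE.inr_mul_inl, hE.inr_mul_inr, hζl, hζr,
          sub_eq_add_neg, add_assoc, add_left_comm, add_comm] }
  have hφ : ∀ u, φ (E u) = E (ζ u) := fun u => by simp [φ]
  refine ⟨φ, ?_⟩
  ext r
  constructor
  · rintro ⟨_, ⟨a, ha, rfl⟩, rfl⟩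
    rw [hφ, hζr, inr_mem_reflections, ← h]
    exact ha
  · rintro ⟨a, ha, rfl⟩
    obtain ⟨c, rfl⟩ := (β.toEquiv.trans (Equiv.addRight b)).surjective a
    exact ⟨E (.inr c), inr_mem_reflections.2 ((h c).2 ha), by rw [hφ]; rfl⟩

theorem exists_eq_reflections (hE : IsDihCoord E) {U : Set R} {S : Set A} {η : Equiv.Perm R}
    (hA : ∀ a : A, a + a + a = 0) (hη : IsCayIso U (reflections E S) η) :
    ∃ T, U = reflections E T := by
  have hl : ∀ a, E (.inl a) ∉ U := by
    intro a ha
    have hstep : ∀ b, (E.symm (η (E (.inl (a + b))))).isLeft =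
        !(E.symm (η (E (.inl b)))).isLeft := by
      intro b
      have h1 := (hη (E (.inl (a + b))) (E (.inl b))).1 (by
        rw [← hE.inl_mul_inl, mul_inv_cancel_right]
        exact ha)
      rw [← E.apply_symm_apply (η (E (.inl (a + b)))), ← E.apply_symm_apply (η (E (.inl b))),
        hE.mul_inv_mem_reflections] at h1
      exact isLeft_ne_of_bipAdj h1
    have h0 := hstep 0
    have h1 := hstep (a + 0)
    have h2 := hstep (a + (a + 0))
    have e : a + (a + (a + 0)) = 0 := by rw [add_zero, ← add_assoc, hA]
    rw [e, h1, h0, Bool.not_not] at h2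
    exact (Bool.eq_not_self _).1 h2
  refine ⟨{a | E (.inr a) ∈ U}, ?_⟩
  ext r
  obtain ⟨a | a, rfl⟩ := E.surjective r
  · exact iff_of_false (hl a) inl_notMem_reflections
  · rw [inr_mem_reflections]
    rfl

end IsDihCoord

theorem exists_isDihCoord {A R : Type*} [AddCommGroup A] [Group R] (ι : Multiplicative A →* R)
    (x : R) (hinj : Function.Injective ι) (hx2 : x ^ 2 = 1) (hxr : x ∉ ι.range)
    (hconj : ∀ a, x⁻¹ * ι a * x = ι a⁻¹)
    (hcover : ∀ r : R, r ∈ ι.range ∨ ∃ a, r = ι a * x) :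
    ∃ E : A ⊕ A ≃ R, IsDihCoord E ∧ ∀ a, E (.inr a) = ι (Multiplicative.ofAdd a) * x := by
  have hxx : x * x = 1 := by rw [← sq, hx2]
  have hcomm : ∀ a, x * ι a = ι a⁻¹ * x := by
    intro a
    rw [← hconj, inv_eq_of_mul_eq_one_left hxx]
    simp only [mul_assoc, hxx, mul_one]
  let f : A ⊕ A → R :=
    Sum.elim (fun a => ι (Multiplicative.ofAdd a)) fun a => ι (Multiplicative.ofAdd a) * x
  have hne : ∀ a b, ι a ≠ ι b * x := fun a b h =>
    hxr ⟨b⁻¹ * a, by rw [map_mul, h, map_inv, inv_mul_cancel_left]⟩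
  have hf : Function.Bijective f := by
    constructor
    · rintro (a | a) (b | b) h
      · exact congrArg Sum.inl (hinj h)
      · exact absurd h (hne _ _)
      · exact absurd h.symm (hne _ _)
      · exact congrArg Sum.inr (hinj (mul_right_cancel h))
    · intro r
      rcases hcover r with ⟨a, rfl⟩ | ⟨a, rfl⟩
      exacts [⟨.inl a.toAdd, rfl⟩, ⟨.inr a.toAdd, rfl⟩]
  refine ⟨Equiv.ofBijective f hf, ⟨fun a b => ?_, fun a b => ?_, fun a b => ?_, fun a b => ?_⟩,
    fun _ => rfl⟩ <;> simp only [Equiv.ofBijective_apply, f, Sum.elim_inl, Sum.elim_inr]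
  · rw [ofAdd_add, map_mul]
  · rw [ofAdd_add, map_mul, mul_assoc]
  · rw [mul_assoc, hcomm, ← mul_assoc, ← map_mul, ofAdd_sub, div_eq_mul_inv]
  · rw [mul_assoc, ← mul_assoc x, hcomm, mul_assoc, hxx, mul_one, ← map_mul, ofAdd_sub,
      div_eq_mul_inv]

/-- The coordinates of the connection set. -/
def connSet : Set A₂₇ :=
  {(0, 0, 0), (1, 0, 0), (0, 1, 0), (0, 0, 1), (1, 1, 0), (2, 2, 0), (0, 1, 1), (0, 2, 2),
    (2, 2, 2)}

theorem affEquivalent_connSet : AffEquivalent connSet (quadric (-1)) := by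
  let β : A₂₇ ≃+ A₂₇ :=
    { toFun := fun P => (P.2.1, P.2.2 - P.1, P.1 + P.2.1 - (P.2.2 - P.1))
      invFun := fun P => (P.2.2 - P.1 + P.2.1, P.1, P.2.2 - P.1 + P.2.1 + P.2.1)
      left_inv := fun P => Prod.ext (by ring) (Prod.ext rfl (by ring))
      right_inv := fun P => Prod.ext rfl (Prod.ext (by ring) (by ring))
      map_add' := fun P Q => by
        simp only [Prod.fst_add, Prod.snd_add, Prod.mk_add_mk]
        refine Prod.ext ?_ (Prod.ext ?_ ?_) <;> ring }
  refine ⟨β, 0, fun P => ?_⟩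
  simp only [connSet, quadric, Set.mem_insert_iff, Set.mem_singleton_iff, Set.mem_ofPred_eq,
    add_zero]
  revert P
  simp only [β, AddEquiv.coe_mk, Equiv.coe_fn_mk]
  decide

theorem not_line_quadric_one {a b c : A₂₇} (ha : a ∈ quadric 1) (hb : b ∈ quadric 1)
    (hc : c ∈ quadric 1) (h : a - b = b - c) : a = b := by
  have haniso : ∀ x y : ZMod 3, x ^ 2 + y ^ 2 = 0 → x = 0 ∧ y = 0 := by decide
  simp only [quadric, Set.mem_ofPred_eq] at ha hb hc
  simp only [Prod.ext_iff, Prod.fst_sub, Prod.snd_sub] at h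
  obtain ⟨h1, h2, h3⟩ := h
  have e1 : c.1 = 2 * b.1 - a.1 := by linear_combination h1
  have e2 : c.2.1 = 2 * b.2.1 - a.2.1 := by linear_combination h2
  have e3 : c.2.2 = 2 * b.2.2 - a.2.2 := by linear_combination h3
  rw [e1, e2, e3] at hc
  obtain ⟨d1, d2⟩ := haniso (a.1 - b.1) (a.2.1 - b.2.1) (by
    linear_combination hc + ha - 2 * hb
      + ((a.1 - b.1) ^ 2 + (a.2.1 - b.2.1) ^ 2) * three_eq_zero)
  have f1 : a.1 = b.1 := sub_eq_zero.1 d1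
  have f2 : a.2.1 = b.2.1 := sub_eq_zero.1 d2
  exact Prod.ext f1 (Prod.ext f2 (by rw [ha, hb, f1, f2]))

theorem IsDihCoord.not_exists_mulEquiv {R : Type*} [Group R] {E : A₂₇ ⊕ A₂₇ ≃ R}
    (hE : IsDihCoord E) :
    ¬ ∃ φ : R ≃* R, φ '' reflections E connSet = reflections E (quadric 1) := by
  rintro ⟨φ, hφ⟩
  have hmem : ∀ a ∈ connSet, ∃ b ∈ quadric 1, E (.inr b) = φ (E (.inr a)) := fun a ha => by
    have : φ (E (.inr a)) ∈ reflections E (quadric 1) :=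
      hφ ▸ Set.mem_image_of_mem _ (inr_mem_reflections.2 ha)
    exact this
  obtain ⟨a, ha, ea⟩ := hmem (0, 0, 0) (by simp [connSet])
  obtain ⟨b, hb, eb⟩ := hmem (1, 1, 0) (by simp [connSet])
  obtain ⟨c, hc, ec⟩ := hmem (2, 2, 0) (by simp [connSet])
  have hab : a = b := by
    refine not_line_quadric_one ha hb hc (Sum.inl_injective (E.injective ?_))
    rw [← hE.inr_mul_inr, ← hE.inr_mul_inr, ea, eb, ec, ← map_mul φ, ← map_mul φ, hE.inr_mul_inr,
      hE.inr_mul_inr]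
    rfl
  rw [hab, eb] at ea
  have := Sum.inr_injective (E.injective (φ.injective ea))
  exact absurd this (by decide)

end Dihedral

theorem stmt18 (R : Type*) [Group R]
    (ι : Multiplicative (ZMod 3 × ZMod 3 × ZMod 3) →* R) (x : R)
    (hinj : Function.Injective ι) (hx2 : x ^ 2 = 1) (hxr : x ∉ ι.range)
    (hconj : ∀ a, x⁻¹ * ι a * x = ι a⁻¹)
    (hcover : ∀ r : R, r ∈ ι.range ∨ ∃ a, r = ι a * x)
    (e₁ e₂ e₃ : R)
    (he₁ : e₁ = ι (Multiplicative.ofAdd ((1, 0, 0) : ZMod 3 × ZMod 3 × ZMod 3)))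
    (he₂ : e₂ = ι (Multiplicative.ofAdd ((0, 1, 0) : ZMod 3 × ZMod 3 × ZMod 3)))
    (he₃ : e₃ = ι (Multiplicative.ofAdd ((0, 0, 1) : ZMod 3 × ZMod 3 × ZMod 3)))
    (S : Set R)
    (hS : S = {x, e₁ * x, e₂ * x, e₃ * x, e₁ * e₂ * x, e₁ ^ 2 * e₂ ^ 2 * x,
      e₂ * e₃ * x, e₂ ^ 2 * e₃ ^ 2 * x, e₁ ^ 2 * e₂ ^ 2 * e₃ ^ 2 * x}) :
    -- the automorphism group of `Γ = Cay(R,S)` has order `46656 = 2⁶·3⁶`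
    Nat.card (CayAut S) = 46656 ∧
    -- `Aut(Γ)` contains exactly two conjugacy classes of regular subgroups isomorphic to `R`
    (∃ X Y : Subgroup (Equiv.Perm R),
      IsRegularRSubgroupOfAut S X ∧ IsRegularRSubgroupOfAut S Y ∧ ¬ ConjInAut S X Y ∧
      ∀ Z : Subgroup (Equiv.Perm R), IsRegularRSubgroupOfAut S Z →
        ConjInAut S Z X ∨ ConjInAut S Z Y) ∧
    -- consequently `Γ` is not a DCI-graph and `R` is not a CI-group
    ¬ IsDCIGraph S ∧ ¬ IsCIGroup R := by
  obtain ⟨E, hE, hEr⟩ := exists_isDihCoord ι x hinj hx2 hxr hconj hcover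
  have hSE : S = reflections E connSet := by
    have hr : ∀ a : A₂₇, E (.inr a) = e₁ ^ a.1.val * e₂ ^ a.2.1.val * e₃ ^ a.2.2.val * x := by
      intro a
      rw [hEr, he₁, he₂, he₃, ← map_pow ι, ← map_pow ι, ← map_pow ι, ← map_mul ι, ← map_mul ι]
      congr 2
      revert a
      decide
    simp only [hS, reflections, connSet, Set.image_insert_eq, Set.image_singleton, hr]
    have h2 : (2 : ZMod 3).val = 2 := rfl
    have h1 : (1 : ZMod 3).val = 1 := rfl
    simp [h1, h2]
  subst hSE
  obtain ⟨κ, hκ⟩ := affEquivalent_connSet.exists_perm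
  obtain ⟨μ, hμ⟩ := exists_perm_quadric_incid (ε := -1) (Or.inr rfl)
  obtain ⟨ν, hν⟩ := exists_perm_quadric_incid (ε := 1) (Or.inl rfl)
  have hincid : ∀ u v, sumAdj connSet u v ↔ bipAdj Incid (κ.trans μ u) (κ.trans μ v) :=
    fun u v => (hκ u v).trans (hμ _ _)
  have hcay : ∀ u v, u * v⁻¹ ∈ reflections E connSet ↔
      bipAdj Incid ((κ.trans μ) (E.symm u)) ((κ.trans μ) (E.symm v)) := by
    intro u v
    rw [← hincid, ← hE.mul_inv_mem_reflections, E.apply_symm_apply, E.apply_symm_apply]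
  have hiso : IsCayIso (reflections E (quadric 1)) (reflections E connSet)
      (E.symm.trans ((ν.trans (κ.trans μ).symm).trans E)) := by
    intro u v
    rw [hcay, ← E.apply_symm_apply u, ← E.apply_symm_apply v, hE.mul_inv_mem_reflections, hν]
    simp
  have hno := hE.not_exists_mulEquiv
  have hdci : ¬ IsDCIGraph (reflections E connSet) := fun h =>
    hno (h _ ⟨_, hiso.symm⟩)
  refine ⟨?_, exists_two_classes hiso hno ?_, hdci, fun h => hdci (h _ (hE.inv_reflections _))⟩
  · exact (card_relAut_congr (E.symm.trans (κ.trans μ)) hcay).trans card_relAut_incid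
  · intro U η hη
    obtain ⟨T, rfl⟩ := hE.exists_eq_reflections (by decide) hη
    obtain ⟨ε, hε, hT⟩ := affEquivalent_quadric_of_perm (T := T)
      (ζ := (E.trans (η.trans E.symm)).trans (κ.trans μ)) fun u v => by
        rw [← hE.mul_inv_mem_reflections, hη, hcay]
        simp
    rcases hε with rfl | rfl
    · exact Or.inr (hE.exists_mulEquiv hT)
    · exact Or.inl (hE.exists_mulEquiv (hT.trans affEquivalent_connSet.symm))
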